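/- Let P be a noiseless, finitely supported probability distribution on 𝒳 × {-1,1} and let f : 𝒳 → [-1,1] be lossless with respect to P (I_P(f(X);Y) = I_P(X;Y)). Then for every value s = f(x) attained on the support of P_X and every y ∈ {-1,1}, the conditional probability P(Y = y | f(X) = s) lies in {0, 1}; i.e., each level set of f within the support of P_X contains points of only one class. -/

import Mathlib

open Finset

noncomputable section

/-- The binary label space `𝒴 = {-1, 1} ⊆ ℤ`. -/
abbrev Ybin : Type := ({-1, 1} : Finset ℤ)

/-- The label `+1` as an element of `Ybin`. -/
def yPos : Ybin := ⟨1, by decide⟩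

/-- The label `-1` as an element of `Ybin`. -/
def yNeg : Ybin := ⟨-1, by decide⟩

/-- Probability of a set under a finitely supported pmf `P`. -/
def pr {Ω : Type*} [Fintype Ω] (P : Ω → ℝ) (s : Set Ω) : ℝ :=
  ∑ ω, s.indicator P ω

/-- Entropy `H_P(A)` of a random variable `A` (a function of the sample point),
`H_P(A) = -∑_a P(A=a) log P(A=a)`, written as a sum over sample points. -/
def ent {Ω α : Type*} [Fintype Ω] (P : Ω → ℝ) (A : Ω → α) : ℝ :=
  -∑ ω, P ω * Real.log (pr P {ω' | A ω' = A ω})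

/-- Conditional entropy `H_P(A|B) = -∑_{a,b} P(A=a,B=b) log P(A=a|B=b)`. -/
def condEnt {Ω α β : Type*} [Fintype Ω] (P : Ω → ℝ) (A : Ω → α) (B : Ω → β) : ℝ :=
  -∑ ω, P ω * Real.log (pr P {ω' | A ω' = A ω ∧ B ω' = B ω} / pr P {ω' | B ω' = B ω})

/-- Mutual information `I_P(A;B) = ∑_{a,b} P(A=a,B=b) log (P(A=a,B=b) / (P(A=a) P(B=b)))`. -/
def mi {Ω α β : Type*} [Fintype Ω] (P : Ω → ℝ) (A : Ω → α) (B : Ω → β) : ℝ :=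
  ∑ ω, P ω * Real.log (pr P {ω' | A ω' = A ω ∧ B ω' = B ω} /
      (pr P {ω' | A ω' = A ω} * pr P {ω' | B ω' = B ω}))

/-- Marginal `P_X(x) = ∑_y P(x,y)`. -/
def margX {𝒳 : Type*} [Fintype 𝒳] (P : 𝒳 × Ybin → ℝ) (x : 𝒳) : ℝ :=
  ∑ y, P (x, y)

/-- Risk `R_P(h) = P[sign(h(X)) ≠ Y]`. -/
def risk {𝒳 : Type*} [Fintype 𝒳] (P : 𝒳 × Ybin → ℝ) (h : 𝒳 → ℝ) : ℝ :=
  pr P {ω | Real.sign (h ω.1) ≠ ((ω.2 : ℤ) : ℝ)}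

section FiniteInformation

variable {Ω α β : Type*} [Fintype Ω] {P : Ω → ℝ}

lemma pr_mono (hP : ∀ ω, 0 ≤ P ω) {s t : Set Ω} (hst : s ⊆ t) : pr P s ≤ pr P t :=
  Finset.sum_le_sum fun ω _ => Set.indicator_le_indicator_of_subset hst hP ω

lemma le_pr_of_mem (hP : ∀ ω, 0 ≤ P ω) {s : Set Ω} {ω : Ω} (hω : ω ∈ s) : P ω ≤ pr P s := by
  have h := Finset.single_le_sum (f := fun ω => s.indicator P ω)
    (fun ω _ => Set.indicator_nonneg (fun ω _ => hP ω) ω) (Finset.mem_univ ω)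
  rwa [Set.indicator_of_mem hω] at h

lemma pr_eq_zero {s : Set Ω} (h : ∀ ω ∈ s, P ω = 0) : pr P s = 0 :=
  Finset.sum_eq_zero fun ω _ => Set.indicator_apply_eq_zero.2 (h ω)

/-- The chain rule `I(A;B) = H(B) - H(B|A)`. -/
lemma mi_eq_ent_sub_condEnt (hP : ∀ ω, 0 ≤ P ω) (A : Ω → α) (B : Ω → β) :
    mi P A B = ent P B - condEnt P B A := by
  unfold mi ent condEnt
  rw [sub_neg_eq_add, neg_add_eq_sub, ← Finset.sum_sub_distrib]
  refine Finset.sum_congr rfl fun ω _ => ?_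
  rcases (hP ω).eq_or_lt with h0 | hpos
  · simp [← h0]
  have hAB : 0 < pr P {ω' | A ω' = A ω ∧ B ω' = B ω} :=
    hpos.trans_le (le_pr_of_mem hP ⟨rfl, rfl⟩)
  have hA : 0 < pr P {ω' | A ω' = A ω} := hpos.trans_le (le_pr_of_mem hP rfl)
  have hB : 0 < pr P {ω' | B ω' = B ω} := hpos.trans_le (le_pr_of_mem hP rfl)
  simp only [and_comm (a := B _ = B ω)]
  rw [Real.log_div hAB.ne' (mul_pos hA hB).ne', Real.log_mul hA.ne' hB.ne',
    Real.log_div hAB.ne' hA.ne']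
  ring

/-- If `H(A|B) = 0`, then `A` is determined by `B` on the support of `P`. -/
lemma pr_inter_eq_of_condEnt_eq_zero (hP : ∀ ω, 0 ≤ P ω) {A : Ω → α} {B : Ω → β}
    (h : condEnt P A B = 0) {ω : Ω} (hω : 0 < P ω) :
    pr P {ω' | A ω' = A ω ∧ B ω' = B ω} = pr P {ω' | B ω' = B ω} := by
  have hnonpos : ∀ ω ∈ Finset.univ, P ω *
      Real.log (pr P {ω' | A ω' = A ω ∧ B ω' = B ω} / pr P {ω' | B ω' = B ω}) ≤ 0 := by
    intro ω _
    have hle : pr P {ω' | A ω' = A ω ∧ B ω' = B ω} ≤ pr P {ω' | B ω' = B ω} :=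
      pr_mono hP fun _ h => h.2
    have h0 : ∀ s : Set Ω, 0 ≤ pr P s := fun s =>
      Finset.sum_nonneg fun ω _ => Set.indicator_nonneg (fun ω _ => hP ω) ω
    exact mul_nonpos_of_nonneg_of_nonpos (hP ω)
      (Real.log_nonpos (div_nonneg (h0 _) (h0 _)) (div_le_one_of_le₀ hle (h0 _)))
  have hterm := (Finset.sum_eq_zero_iff_of_nonpos hnonpos).1 (neg_eq_zero.1 h) ω
    (Finset.mem_univ ω)
  have hAB : 0 < pr P {ω' | A ω' = A ω ∧ B ω' = B ω} :=
    hω.trans_le (le_pr_of_mem hP ⟨rfl, rfl⟩)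
  have hB : 0 < pr P {ω' | B ω' = B ω} := hω.trans_le (le_pr_of_mem hP rfl)
  have hlog := (mul_eq_zero.1 hterm).resolve_left hω.ne'
  exact (div_eq_one_iff_eq hB.ne').1 (Real.eq_one_of_pos_of_log_eq_zero (div_pos hAB hB) hlog)

end FiniteInformation

/-- If `P` is noiseless and `f : 𝒳 → [-1,1]` is lossless w.r.t. `P`, then
for every value `s = f x` attained on the support of `P_X` and every `y ∈ {-1,1}`, the
conditional probability `P(Y=y | f(X)=s)` lies in `{0,1}`. -/
theorem lossless_level_sets_pure {𝒳 : Type*} [Fintype 𝒳]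
    (P : 𝒳 × Ybin → ℝ) (hP0 : ∀ ω, 0 ≤ P ω) (hP1 : ∑ ω, P ω = 1)
    (hnoiseless : condEnt P (fun ω => ω.2) (fun ω => ω.1) = 0)
    (f : 𝒳 → ℝ) (hf : ∀ x, f x ∈ Set.Icc (-1 : ℝ) 1)
    (hloss : mi P (fun ω => f ω.1) (fun ω => ω.2) = mi P (fun ω => ω.1) (fun ω => ω.2)) :
    ∀ x : 𝒳, 0 < margX P x → ∀ y : Ybin,
      pr P {ω | ω.2 = y ∧ f ω.1 = f x} / pr P {ω | f ω.1 = f x} ∈ ({0, 1} : Set ℝ) := by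
  intro x _ y
  have hcond : condEnt P (fun ω => ω.2) (fun ω => f ω.1) = 0 := by
    rw [mi_eq_ent_sub_condEnt hP0, mi_eq_ent_sub_condEnt hP0, hnoiseless] at hloss
    linarith
  by_cases h : ∃ ω : 𝒳 × Ybin, 0 < P ω ∧ ω.2 = y ∧ f ω.1 = f x
  · obtain ⟨ω, hω, rfl, hfx⟩ := h
    have heq := pr_inter_eq_of_condEnt_eq_zero hP0 hcond hω
    simp only [hfx] at heq
    have hpos : 0 < pr P {ω' | f ω'.1 = f x} := hω.trans_le (le_pr_of_mem hP0 hfx)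
    right
    rw [Set.mem_singleton_iff, heq, div_self hpos.ne']
  · push Not at h
    left
    rw [pr_eq_zero, zero_div]
    rintro ω ⟨hy, hfx⟩
    by_contra hne
    exact h ω ((hP0 ω).lt_of_ne' hne) hy hfx
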